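/- arXiv:1105.5067 — 5 statements merged into one kernel-verified Lean document; each statement's English description precedes it below -/
import Mathlib

section
/- Shearing versus bending, first part: let φ : 𝕊² → ℝ³ be a smooth immersion, ν a unit normal field for φ, ξ an isometric infinitesimal deformation of φ, and η the rotation vector field of ξ. Then η is an isogauss infinitesimal deformation of φ with respect to ν: for every x ∈ 𝕊² and all X, Y ∈ T_x𝕊² one has ⟨dη_x X, ν x⟩ = 0 and dη_x X × dφ_x Y + dφ_x X × dη_x Y = 0 (the latter expresses tr(dη) = 0, i.e. that η preserves the Gauss curvature to first order). -/
noncomputable section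

open scoped Manifold RealInnerProductSpace
open Metric Module

local notation "ℝ³" => EuclideanSpace ℝ (Fin 3)

instance : Fact (finrank ℝ ℝ³ = 2 + 1) := ⟨by simp⟩

local notation "𝕊²" => sphere (0 : ℝ³) 1

/-- The cross product on `ℝ³ = EuclideanSpace ℝ (Fin 3)`. -/
def cross (a b : ℝ³) : ℝ³ :=
  (EuclideanSpace.equiv (Fin 3) ℝ).symm
    (crossProduct (EuclideanSpace.equiv (Fin 3) ℝ a) (EuclideanSpace.equiv (Fin 3) ℝ b))

/-- `f : 𝕊² → ℝ³` is smooth (`C^∞`). -/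
def Smooth3 (f : 𝕊² → ℝ³) : Prop := ContMDiff (𝓡 2) 𝓘(ℝ, ℝ³) (⊤ : ℕ∞) f

/-- The manifold derivative of `f : 𝕊² → ℝ³` at `x ∈ 𝕊²`. -/
def mfd (f : 𝕊² → ℝ³) (x : 𝕊²) : TangentSpace (𝓡 2) x →L[ℝ] ℝ³ :=
  mfderiv (𝓡 2) 𝓘(ℝ, ℝ³) f x

/-- `ν` is a unit normal field for `φ`. -/
def IsUnitNormalField (φ ν : 𝕊² → ℝ³) : Prop :=
  Smooth3 ν ∧ (∀ x, ‖ν x‖ = 1) ∧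
    ∀ (x : 𝕊²) (X : TangentSpace (𝓡 2) x), ⟪ν x, mfd φ x X⟫ = 0

/-- `φ` has everywhere positive Gauss curvature with respect to `ν`. -/
def PosGaussCurvature (φ ν : 𝕊² → ℝ³) : Prop :=
  ∀ (x : 𝕊²) (X Y : TangentSpace (𝓡 2) x), LinearIndependent ℝ ![X, Y] →
    0 < ⟪cross (mfd ν x X) (mfd ν x Y), cross (mfd φ x X) (mfd φ x Y)⟫

/-- `η` is an isogauss infinitesimal deformation of `φ` with respect to `ν`. -/
def IsIsogaussDeformation (φ ν η : 𝕊² → ℝ³) : Prop :=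
  Smooth3 η ∧
    (∀ (x : 𝕊²) (X : TangentSpace (𝓡 2) x), ⟪mfd η x X, ν x⟫ = 0) ∧
    ∀ (x : 𝕊²) (X Y : TangentSpace (𝓡 2) x),
      cross (mfd η x X) (mfd φ x Y) + cross (mfd φ x X) (mfd η x Y) = 0

/-- `ξ` is an isometric infinitesimal deformation of `φ`. -/
def IsIsometricDeformation (φ ξ : 𝕊² → ℝ³) : Prop :=
  Smooth3 ξ ∧
    ∀ (x : 𝕊²) (X Y : TangentSpace (𝓡 2) x),
      ⟪mfd ξ x X, mfd φ x Y⟫ + ⟪mfd φ x X, mfd ξ x Y⟫ = 0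

/-- `η` is the rotation vector field of the isometric infinitesimal deformation `ξ` of `φ`. -/
def IsRotationField (φ ξ η : 𝕊² → ℝ³) : Prop :=
  Smooth3 η ∧
    ∀ (x : 𝕊²) (X : TangentSpace (𝓡 2) x), mfd ξ x X = cross (η x) (mfd φ x X)

lemma ofLp_cross (a b : ℝ³) : (cross a b).ofLp = crossProduct a.ofLp b.ofLp := rfl

lemma cross_swap (a b : ℝ³) : cross a b = -cross b a :=
  WithLp.ofLp_injective 2 <| by
    simp only [ofLp_cross, WithLp.ofLp_neg, cross_anticomm]

/-- The cross product on `ℝ³` as a continuous bilinear map. -/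
def crossL : ℝ³ →L[ℝ] ℝ³ →L[ℝ] ℝ³ :=
  (LinearMap.mk₂ ℝ cross
    (fun a b c => WithLp.ofLp_injective 2 <| by simp [ofLp_cross])
    (fun r a b => WithLp.ofLp_injective 2 <| by simp [ofLp_cross])
    (fun a b c => WithLp.ofLp_injective 2 <| by simp [ofLp_cross])
    (fun r a b => WithLp.ofLp_injective 2 <| by simp [ofLp_cross])).toContinuousBilinearMap

lemma crossL_apply (a b : ℝ³) : crossL a b = cross a b := rfl

/-- A vector which is coplanar with two independent vectors `p`, `q` is orthogonal to every
common normal of `p` and `q`. -/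
lemma inner_eq_zero_of_cross_eq {p q e f n : ℝ³} (hpq : LinearIndependent ℝ ![p, q])
    (hp : ⟪n, p⟫ = 0) (hq : ⟪n, q⟫ = 0) (h : cross e q = cross f p) : ⟪e, n⟫ = 0 := by
  have hpq' : LinearIndependent ℝ ![p.ofLp, q.ofLp] := by
    have := hpq.map' (EuclideanSpace.equiv (Fin 3) ℝ).toLinearMap
      (LinearMap.ker_eq_bot.2 (EuclideanSpace.equiv (Fin 3) ℝ).injective)
    convert! this using 1
    ext i : 1
    fin_cases i <;> rfl
  have hne := crossProduct_ne_zero_iff_linearIndependent.2 hpq'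
  have h' : crossProduct e.ofLp q.ofLp = crossProduct f.ofLp p.ofLp := congrArg WithLp.ofLp h
  have hdot : ∀ a b : ℝ³, ⟪a, b⟫ = a.ofLp ⬝ᵥ b.ofLp := fun a b => by
    rw [EuclideanSpace.inner_eq_star_dotProduct, star_trivial, dotProduct_comm]
  rw [hdot] at hp hq ⊢
  have hn : crossProduct (crossProduct p.ofLp q.ofLp) n.ofLp = 0 := by
    rw [cross_cross_eq_smul_sub_smul, dotProduct_comm, hp, dotProduct_comm, hq]
    simp
  have he : crossProduct p.ofLp q.ofLp ⬝ᵥ e.ofLp = 0 := by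
    rw [dotProduct_comm, triple_product_permutation, ← cross_anticomm, h', dotProduct_neg,
      dot_cross_self, neg_zero]
  have key := cross_cross_eq_smul_sub_smul' e.ofLp (crossProduct p.ofLp q.ofLp) n.ofLp
  rw [hn, he, map_zero, zero_smul, sub_zero] at key
  exact (smul_eq_zero.1 key.symm).resolve_right hne

/-- If `dΞ = H × dΦ` near `u`, then `dH × dΦ` is symmetric at `u`. -/
lemma cross_fderiv_comm {E : Type*} [NormedAddCommGroup E] [NormedSpace ℝ E]
    {Φ Ξ H : E → ℝ³} {u : E} (hΦ : ContDiffAt ℝ 2 Φ u) (hΞ : ContDiffAt ℝ 2 Ξ u)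
    (hH : DifferentiableAt ℝ H u)
    (h : ∀ᶠ v in nhds u, ∀ X, fderiv ℝ Ξ v X = cross (H v) (fderiv ℝ Φ v X)) (X Y : E) :
    cross (fderiv ℝ H u X) (fderiv ℝ Φ u Y) = cross (fderiv ℝ H u Y) (fderiv ℝ Φ u X) := by
  have hdΦ : DifferentiableAt ℝ (fderiv ℝ Φ) u :=
    (hΦ.fderiv_right (m := 1) le_rfl).differentiableAt one_ne_zero
  have hdΞ : DifferentiableAt ℝ (fderiv ℝ Ξ) u :=
    (hΞ.fderiv_right (m := 1) le_rfl).differentiableAt one_ne_zero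
  have second (A B : E) : fderiv ℝ (fderiv ℝ Ξ) u A B =
      cross (H u) (fderiv ℝ (fderiv ℝ Φ) u A B) + cross (fderiv ℝ H u A) (fderiv ℝ Φ u B) := by
    have h₁ : HasFDerivAt (fun v => fderiv ℝ Ξ v B) ((fderiv ℝ (fderiv ℝ Ξ) u).flip B) u :=
      (ContinuousLinearMap.apply ℝ ℝ³ B).hasFDerivAt.comp u hdΞ.hasFDerivAt
    have h₂ : HasFDerivAt (fun v => fderiv ℝ Φ v B) ((fderiv ℝ (fderiv ℝ Φ) u).flip B) u :=
      (ContinuousLinearMap.apply ℝ ℝ³ B).hasFDerivAt.comp u hdΦ.hasFDerivAt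
    have h₃ := crossL.hasFDerivAt_of_bilinear hH.hasFDerivAt h₂
    have h₄ := h₃.congr_of_eventuallyEq (h.mono fun v hv => hv B)
    exact DFunLike.congr_fun (h₁.unique h₄) A
  have symmΦ := hΦ.isSymmSndFDerivAt (by simp) X Y
  have symmΞ := hΞ.isSymmSndFDerivAt (by simp) X Y
  rw [second, second, symmΦ] at symmΞ
  exact add_left_cancel symmΞ

/-- If `dξ = η × dφ` on the sphere, then `dη × dφ` is symmetric. -/
lemma IsRotationField.cross_mfd_comm {φ ξ η : 𝕊² → ℝ³} (hφ : Smooth3 φ) (hξ : Smooth3 ξ)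
    (hη : IsRotationField φ ξ η) (x : 𝕊²) (X Y : TangentSpace (𝓡 2) x) :
    cross (mfd η x X) (mfd φ x Y) = cross (mfd η x Y) (mfd φ x X) := by
  set e := extChartAt (𝓡 2) x
  have hopen : IsOpen e.target := isOpen_extChartAt_target x
  have hx : e x ∈ e.target := mem_extChartAt_target x
  have hes : ContMDiffOn 𝓘(ℝ, EuclideanSpace ℝ (Fin 2)) (𝓡 2) (⊤ : ℕ∞) e.symm e.target :=
    contMDiffOn_extChartAt_symm x
  have hsmooth {f : 𝕊² → ℝ³} (hf : Smooth3 f) : ContDiffAt ℝ 2 (f ∘ e.symm) (e x) :=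
    ((hf.comp_contMDiffOn hes).contDiffOn.contDiffAt (hopen.mem_nhds hx)).of_le
      (WithTop.coe_le_coe.2 (le_top (a := (2 : ℕ∞))))
  have hmd {f : 𝕊² → ℝ³} (hf : Smooth3 f) (y : 𝕊²) : MDifferentiableAt (𝓡 2) 𝓘(ℝ, ℝ³) f y :=
    (hf y).mdifferentiableAt (by simp)
  have hderiv {f : 𝕊² → ℝ³} (hf : Smooth3 f) : mfd f x = fderiv ℝ (f ∘ e.symm) (e x) := by
    rw [mfd, (hmd hf x).mfderiv, ModelWithCorners.range_eq_univ, fderivWithin_univ]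
    rfl
  have hchain {f : 𝕊² → ℝ³} (hf : Smooth3 f) {v : EuclideanSpace ℝ (Fin 2)}
      (hv : v ∈ e.target) (Z : EuclideanSpace ℝ (Fin 2)) : fderiv ℝ (f ∘ e.symm) v Z =
      mfd f (e.symm v) (mfderiv 𝓘(ℝ, EuclideanSpace ℝ (Fin 2)) (𝓡 2) e.symm v Z) := by
    rw [← mfderiv_eq_fderiv]
    exact mfderiv_comp_apply v (hmd hf _)
      ((hes.contMDiffAt (hopen.mem_nhds hv)).mdifferentiableAt (by simp)) Z
  rw [hderiv hη.1, hderiv hφ]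
  refine cross_fderiv_comm (hsmooth hφ) (hsmooth hξ)
    ((hsmooth hη.1).differentiableAt two_ne_zero) ?_ X Y
  filter_upwards [hopen.mem_nhds hx] with v hv Z
  rw [hchain hξ hv, hchain hφ hv]
  exact hη.2 _ _

/-- **Shearing vs. bending, first part**: the rotation vector field of an isometric
infinitesimal deformation is an isogauss infinitesimal deformation of the same surface. -/
theorem rotation_field_isogauss (φ ν ξ η : 𝕊² → ℝ³)
    (hφ : Smooth3 φ) (hφimm : ∀ x : 𝕊², Function.Injective (mfd φ x))
    (hν : IsUnitNormalField φ ν)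
    (hξ : IsIsometricDeformation φ ξ)
    (hη : IsRotationField φ ξ η) :
    IsIsogaussDeformation φ ν η := by
  have comm := hη.cross_mfd_comm hφ hξ.1
  refine ⟨hη.1, fun x X => ?_, fun x X Y => ?_⟩
  · rcases eq_or_ne X 0 with rfl | hX
    · simp
    have hdim : 1 < finrank ℝ (TangentSpace (𝓡 2) x) :=
      one_lt_two.trans_eq (finrank_euclideanSpace_fin (𝕜 := ℝ) (n := 2)).symm
    obtain ⟨Y, hXY⟩ := exists_linearIndependent_pair_of_one_lt_finrank hdim hX
    have hind : LinearIndependent ℝ ![mfd φ x X, mfd φ x Y] := by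
      convert! hXY.map' (mfd φ x).toLinearMap (LinearMap.ker_eq_bot.2 (hφimm x)) using 1
      ext i : 1
      fin_cases i <;> rfl
    exact inner_eq_zero_of_cross_eq hind (hν.2.2 x X) (hν.2.2 x Y) (comm x X Y)
  · rw [comm x X Y, cross_swap (mfd φ x X), add_neg_cancel]
end
end

section
/- Darboux wreath step: let φ : 𝕊² → ℝ³ be a smooth immersion with unit normal field ν, suppose the support function h := ⟨ν, φ⟩ vanishes nowhere, and let ψ := (1/h)·ν be the polar dual of φ. Let ξ be an isometric infinitesimal deformation of φ with rotation vector field η and translation vector field τ, and set ζ := τ × ψ − η (pointwise operations). Then dζ_x X = τ x × dψ_x X for every x ∈ 𝕊² and every X ∈ T_x𝕊²; consequently ζ is an isometric infinitesimal deformation of the polar dual ψ with rotation vector field τ and translation vector field −η. -/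
noncomputable section

open scoped Manifold RealInnerProductSpace
open Metric Module

local notation "ℝ³" => EuclideanSpace ℝ (Fin 3)

local notation "𝕊²" => sphere (0 : ℝ³) 1

/-- The cross product as a continuous bilinear map. -/
def crossCLM : ℝ³ →L[ℝ] ℝ³ →L[ℝ] ℝ³ :=
  LinearMap.toContinuousLinearMap <|
    (LinearMap.toContinuousLinearMap : (ℝ³ →ₗ[ℝ] ℝ³) ≃ₗ[ℝ] (ℝ³ →L[ℝ] ℝ³)).toLinearMap ∘ₗ
      LinearMap.mk₂ ℝ cross (fun a b c => by simp [cross]) (fun a b c => by simp [cross])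
        (fun a b c => by simp [cross]) (fun a b c => by simp [cross])

lemma crossCLM_apply (a b : ℝ³) : crossCLM a b = cross a b := rfl

lemma inner_eq_sum (a b : ℝ³) : ⟪a, b⟫ = a 0 * b 0 + a 1 * b 1 + a 2 * b 2 := by
  simp [PiLp.inner_apply, Fin.sum_univ_three]; ring

lemma cross_apply_zero (a b : ℝ³) : cross a b 0 = a 1 * b 2 - a 2 * b 1 := by
  simp [cross, cross_apply]

lemma cross_apply_one (a b : ℝ³) : cross a b 1 = a 2 * b 0 - a 0 * b 2 := by
  simp [cross, cross_apply]

lemma cross_apply_two (a b : ℝ³) : cross a b 2 = a 0 * b 1 - a 1 * b 0 := by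
  simp [cross, cross_apply]

lemma inner_cross_add_inner_cross (t a b : ℝ³) : ⟪cross t a, b⟫ + ⟪a, cross t b⟫ = 0 := by
  simp only [inner_eq_sum, cross_apply_zero, cross_apply_one, cross_apply_two]; ring

/-- The vector triple product expansion. -/
lemma cross_cross_eq (a b c : ℝ³) : cross (cross a b) c = ⟪a, c⟫ • b - ⟪b, c⟫ • a := by
  ext i
  fin_cases i <;>
    simp [inner_eq_sum, cross_apply_zero, cross_apply_one, cross_apply_two] <;> ring

lemma neg_cross_eq (a b : ℝ³) : -cross a b = cross b a := by
  ext i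
  fin_cases i <;>
    simp [cross_apply_zero, cross_apply_one, cross_apply_two] <;> ring

/-- If `n` is orthogonal to the linearly independent vectors `a` and `b`, every vector orthogonal to
`a × b` is orthogonal to `n`. -/
lemma inner_eq_zero_of_inner_cross_eq_zero {a b n v : ℝ³} (hab : LinearIndependent ℝ ![a, b])
    (ha : ⟪n, a⟫ = 0) (hb : ⟪n, b⟫ = 0) (hv : ⟪cross a b, v⟫ = 0) : ⟪n, v⟫ = 0 := by
  have hc : cross a b ≠ 0 := by
    intro h
    have h₁ : cross (cross a b) a = 0 := by rw [h, ← crossCLM_apply]; simp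
    rw [cross_cross_eq] at h₁
    have := LinearIndependent.pair_iff.1 hab (-⟪b, a⟫) ⟪a, a⟫ (by rw [← h₁]; module)
    have h₂ := inner_self_eq_zero.1 this.2
    exact hab.ne_zero 0 (by simpa using h₂)
  have h₁ : cross (cross a b) n = 0 := by
    rw [cross_cross_eq, real_inner_comm, ha, real_inner_comm, hb]; simp
  have h₂ : cross (cross (cross a b) n) (cross a b) = 0 := by
    rw [h₁, ← crossCLM_apply]; simp
  rw [cross_cross_eq] at h₂
  have h₃ : ⟪cross a b, cross a b⟫ • ⟪n, v⟫ = 0 := by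
    rw [smul_eq_mul, ← real_inner_smul_left, sub_eq_zero.1 h₂, real_inner_smul_left,
      hv, mul_zero]
  exact (smul_eq_zero.1 h₃).resolve_left (inner_self_ne_zero.2 hc)

/-- Integrability condition: if `Dg = w × Df`, then `Dw X × Df Y` is symmetric in `X` and `Y`. -/
lemma cross_fderiv_symm {V : Type*} [NormedAddCommGroup V] [NormedSpace ℝ V] {f g w : V → ℝ³}
    {u : V} (hf : ContDiffAt ℝ 2 f u) (hg : ContDiffAt ℝ 2 g u) (hw : DifferentiableAt ℝ w u)
    (h : ∀ᶠ z in nhds u, ∀ Z, fderiv ℝ g z Z = cross (w z) (fderiv ℝ f z Z)) (X Y : V) :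
    cross (fderiv ℝ w u X) (fderiv ℝ f u Y) = cross (fderiv ℝ w u Y) (fderiv ℝ f u X) := by
  have hDf : DifferentiableAt ℝ (fderiv ℝ f) u :=
    (hf.fderiv_right (m := 1) (by norm_num)).differentiableAt (by norm_num)
  have hDg : DifferentiableAt ℝ (fderiv ℝ g) u :=
    (hg.fderiv_right (m := 1) (by norm_num)).differentiableAt (by norm_num)
  have key (A B : V) : fderiv ℝ (fderiv ℝ g) u A B =
      cross (fderiv ℝ w u A) (fderiv ℝ f u B) + cross (w u) (fderiv ℝ (fderiv ℝ f) u A B) := by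
    have h₁ : HasFDerivAt (fun z => fderiv ℝ g z B) _ u :=
      hDg.hasFDerivAt.clm_apply (hasFDerivAt_const B u)
    have h₂ : HasFDerivAt (fun z => fderiv ℝ f z B) _ u :=
      hDf.hasFDerivAt.clm_apply (hasFDerivAt_const B u)
    have h₃ := crossCLM.hasFDerivAt_of_bilinear hw.hasFDerivAt h₂
    have h₄ := h₃.congr_of_eventuallyEq (h.mono fun z hz => hz B)
    have := DFunLike.congr_fun (h₁.unique h₄) A
    simpa [crossCLM_apply, add_comm] using this
  have sf := (hf.isSymmSndFDerivAt (by simp)).eq X Y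
  have sg := (hg.isSymmSndFDerivAt (by simp)).eq X Y
  rw [key, key, sf] at sg
  exact add_right_cancel sg

lemma Smooth3.cross {a b : 𝕊² → ℝ³} (ha : Smooth3 a) (hb : Smooth3 b) :
    Smooth3 fun x => cross (a x) (b x) :=
  crossCLM.isBoundedBilinearMap.contDiff.contMDiff.comp (ha.prodMk_space hb)

lemma Smooth3.sub {a b : 𝕊² → ℝ³} (ha : Smooth3 a) (hb : Smooth3 b) :
    Smooth3 fun x => a x - b x :=
  ContMDiff.sub ha hb

lemma Smooth3.inv_inner_smul {a b : 𝕊² → ℝ³} (ha : Smooth3 a) (hb : Smooth3 b)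
    (h : ∀ x, ⟪a x, b x⟫ ≠ 0) : Smooth3 fun x => (⟪a x, b x⟫)⁻¹ • a x := by
  have h₁ : ContMDiff (𝓡 2) 𝓘(ℝ, ℝ) (⊤ : ℕ∞) fun x => ⟪a x, b x⟫ :=
    (contDiff_inner (𝕜 := ℝ) (E := ℝ³)).contMDiff.comp (ha.prodMk_space hb)
  exact (h₁.inv₀ h).smul ha

/-- The expression of a map on the sphere in the preferred chart at `x`. -/
def inChart (x : 𝕊²) (f : 𝕊² → ℝ³) : EuclideanSpace ℝ (Fin 2) → ℝ³ :=
  f ∘ (extChartAt (𝓡 2) x).symm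

lemma inChart_apply_self (x : 𝕊²) (f : 𝕊² → ℝ³) :
    inChart x f (extChartAt (𝓡 2) x x) = f x := by
  simp [inChart]

lemma Smooth3.contDiffAt_inChart {f : 𝕊² → ℝ³} (hf : Smooth3 f) (x : 𝕊²)
    {n : ℕ} : ContDiffAt ℝ n (inChart x f) (extChartAt (𝓡 2) x x) := by
  have h := (contMDiffOn_extChartAt_symm (I := 𝓡 2) (n := (⊤ : ℕ∞)) x).contMDiffAt
    (extChartAt_target_mem_nhds (I := 𝓡 2) x)
  exact ((hf.contMDiffAt.comp _ h).contDiffAt).of_le (by exact_mod_cast le_top)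

lemma Smooth3.mfd_eq_fderiv_inChart {f : 𝕊² → ℝ³} (hf : Smooth3 f) (x : 𝕊²) :
    mfd f x = fderiv ℝ (inChart x f) (extChartAt (𝓡 2) x x) := by
  have h : MDifferentiableAt (𝓡 2) 𝓘(ℝ, ℝ³) f x := hf.mdifferentiable (by simp) x
  rw [mfd, h.mfderiv]
  simp only [writtenInExtChartAt, extChartAt_model_space_eq_id, PartialEquiv.refl_coe,
    modelWithCornersSelf_coe, Set.range_id, fderivWithin_univ]
  rfl

lemma Smooth3.fderiv_inChart {f : 𝕊² → ℝ³} (hf : Smooth3 f) (x : 𝕊²)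
    {z : EuclideanSpace ℝ (Fin 2)} (hz : z ∈ (extChartAt (𝓡 2) x).target)
    (Z : EuclideanSpace ℝ (Fin 2)) :
    fderiv ℝ (inChart x f) z Z = mfd f ((extChartAt (𝓡 2) x).symm z)
      (mfderiv 𝓘(ℝ, EuclideanSpace ℝ (Fin 2)) (𝓡 2) (extChartAt (𝓡 2) x).symm z Z) := by
  have h : MDifferentiableAt 𝓘(ℝ, EuclideanSpace ℝ (Fin 2)) (𝓡 2) (extChartAt (𝓡 2) x).symm z :=
    ((contMDiffOn_extChartAt_symm (I := 𝓡 2) (n := (⊤ : ℕ∞)) x).contMDiffAt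
      ((isOpen_extChartAt_target (I := 𝓡 2) x).mem_nhds hz)).mdifferentiableAt (by simp)
  rw [← mfderiv_eq_fderiv, inChart, mfderiv_comp z (hf.mdifferentiable (by simp) _) h]
  rfl

lemma Smooth3.mfd_sub {a b : 𝕊² → ℝ³} (ha : Smooth3 a) (hb : Smooth3 b) (x : 𝕊²)
    (X : TangentSpace (𝓡 2) x) : mfd (fun x => a x - b x) x X = mfd a x X - mfd b x X := by
  have da := (ha.contDiffAt_inChart x (n := 1)).differentiableAt (by simp)
  have db := (hb.contDiffAt_inChart x (n := 1)).differentiableAt (by simp)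
  rw [(ha.sub hb).mfd_eq_fderiv_inChart, ha.mfd_eq_fderiv_inChart, hb.mfd_eq_fderiv_inChart]
  exact DFunLike.congr_fun (da.hasFDerivAt.sub db.hasFDerivAt).fderiv X

lemma Smooth3.mfd_cross {a b : 𝕊² → ℝ³} (ha : Smooth3 a) (hb : Smooth3 b) (x : 𝕊²)
    (X : TangentSpace (𝓡 2) x) :
    mfd (fun x => _root_.cross (a x) (b x)) x X =
      _root_.cross (a x) (mfd b x X) + _root_.cross (mfd a x X) (b x) := by
  have da := (ha.contDiffAt_inChart x (n := 1)).differentiableAt (by simp)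
  have db := (hb.contDiffAt_inChart x (n := 1)).differentiableAt (by simp)
  rw [(ha.cross hb).mfd_eq_fderiv_inChart, ha.mfd_eq_fderiv_inChart, hb.mfd_eq_fderiv_inChart]
  have h := DFunLike.congr_fun
    (crossCLM.hasFDerivAt_of_bilinear da.hasFDerivAt db.hasFDerivAt).fderiv X
  simp only [ContinuousLinearMap.precompR_apply, crossCLM_apply, inChart_apply_self] at h
  exact h

/-- The differential of the rotation field is orthogonal to the unit normal field. -/
lemma IsRotationField.inner_mfd_eq_zero {φ ν ξ η : 𝕊² → ℝ³} (hφ : Smooth3 φ)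
    (hφimm : ∀ x : 𝕊², Function.Injective (mfd φ x)) (hν : IsUnitNormalField φ ν)
    (hξ : Smooth3 ξ) (hη : IsRotationField φ ξ η) (x : 𝕊²) (X : TangentSpace (𝓡 2) x) :
    ⟪ν x, mfd η x X⟫ = 0 := by
  have hsymm (Y Z : TangentSpace (𝓡 2) x) :
      cross (mfd η x Y) (mfd φ x Z) = cross (mfd η x Z) (mfd φ x Y) := by
    rw [hη.1.mfd_eq_fderiv_inChart, hφ.mfd_eq_fderiv_inChart]
    refine cross_fderiv_symm (g := inChart x ξ) (hφ.contDiffAt_inChart x (n := 2))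
      (hξ.contDiffAt_inChart x (n := 2))
      ((hη.1.contDiffAt_inChart x (n := 1)).differentiableAt (by simp)) ?_ Y Z
    filter_upwards [extChartAt_target_mem_nhds (I := 𝓡 2) x] with z hz Z
    rw [hξ.fderiv_inChart x hz, hφ.fderiv_inChart x hz, hη.2]
    rfl
  obtain ⟨Y, hXY⟩ | hX : (∃ Y : TangentSpace (𝓡 2) x, LinearIndependent ℝ ![X, Y]) ∨ X = 0 := by
    by_cases hX : X = 0
    · exact Or.inr hX
    · refine Or.inl (exists_linearIndependent_pair_of_one_lt_finrank (R := ℝ)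
        (M := EuclideanSpace ℝ (Fin 2)) (by simp) hX)
  · have hli : LinearIndependent ℝ ![mfd φ x X, mfd φ x Y] := by
      refine LinearIndependent.pair_iff.2 fun s t hst => LinearIndependent.pair_iff.1 hXY s t ?_
      apply hφimm x
      rw [map_add, map_smul, map_smul, hst, map_zero]
    refine inner_eq_zero_of_inner_cross_eq_zero hli (hν.2.2 x X) (hν.2.2 x Y) ?_
    have h := congrArg (fun v => ⟪v, mfd φ x X⟫) (hsymm X Y)
    simp only [inner_eq_sum, cross_apply_zero, cross_apply_one, cross_apply_two] at h ⊢
    linear_combination -h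
  · simp [hX]

/-- **Darboux wreath step**: if `ξ` is an isometric infinitesimal deformation of `φ` with
rotation field `η` and translation field `τ`, then `ζ = τ × ψ − η` is an isometric
infinitesimal deformation of the polar dual `ψ = ν / h`, with rotation field `τ` and
translation field `−η`. -/
theorem darboux_wreath_step (φ ν ψ ξ η τ ζ : 𝕊² → ℝ³)
    (hφ : Smooth3 φ) (hφimm : ∀ x : 𝕊², Function.Injective (mfd φ x))
    (hν : IsUnitNormalField φ ν)
    (hh : ∀ x : 𝕊², ⟪ν x, φ x⟫ ≠ 0)
    (hψ : ∀ x : 𝕊², ψ x = (⟪ν x, φ x⟫)⁻¹ • ν x)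
    (hξ : IsIsometricDeformation φ ξ)
    (hη : IsRotationField φ ξ η)
    (hτ : ∀ x : 𝕊², τ x = ξ x - cross (η x) (φ x))
    (hζ : ∀ x : 𝕊², ζ x = cross (τ x) (ψ x) - η x) :
    (∀ (x : 𝕊²) (X : TangentSpace (𝓡 2) x), mfd ζ x X = cross (τ x) (mfd ψ x X)) ∧
      (∀ (x : 𝕊²) (X Y : TangentSpace (𝓡 2) x),
        ⟪mfd ζ x X, mfd ψ x Y⟫ + ⟪mfd ψ x X, mfd ζ x Y⟫ = 0) ∧
      ∀ x : 𝕊², ζ x - cross (τ x) (ψ x) = -η x := by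
  obtain rfl : ψ = fun x => (⟪ν x, φ x⟫)⁻¹ • ν x := funext hψ
  obtain rfl : τ = fun x => ξ x - cross (η x) (φ x) := funext hτ
  obtain rfl : ζ = fun x => cross (ξ x - cross (η x) (φ x)) ((⟪ν x, φ x⟫)⁻¹ • ν x) - η x :=
    funext hζ
  have sψ := hν.1.inv_inner_smul hφ hh
  have sτ := hξ.1.sub (hη.1.cross hφ)
  have main (x : 𝕊²) (X : TangentSpace (𝓡 2) x) :
      mfd (fun x => cross (ξ x - cross (η x) (φ x)) ((⟪ν x, φ x⟫)⁻¹ • ν x) - η x) x X =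
        cross (ξ x - cross (η x) (φ x)) (mfd (fun x => (⟪ν x, φ x⟫)⁻¹ • ν x) x X) := by
    rw [(sτ.cross sψ).mfd_sub hη.1, sτ.mfd_cross sψ, hξ.1.mfd_sub (hη.1.cross hφ),
      hη.1.mfd_cross hφ, hη.2, sub_add_cancel_left, neg_cross_eq, cross_cross_eq,
      real_inner_smul_right, real_inner_smul_right, real_inner_comm (ν x) (φ x),
      real_inner_comm (ν x) (mfd η x X), hη.inner_mfd_eq_zero hφ hφimm hν hξ.1,
      inv_mul_cancel₀ (hh x)]
    simp
  refine ⟨main, fun x X Y => ?_, fun x => by simp⟩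
  rw [main, main]
  exact inner_cross_add_inner_cross _ _ _
end
end

section
/- Mixed determinants via alternating forms: let V be an n-dimensional real vector space with n ≥ 1, let ω₁, …, ωₙ be linear endomorphisms of V, let f be an alternating n-form on V, and let v₁, …, vₙ ∈ V. Then Σ_{σ ∈ Sₙ} f(ω_{σ(1)} v₁, …, ω_{σ(n)} vₙ) = c · f(v₁, …, vₙ), where c = Σ_{∅ ≠ S ⊆ {1,…,n}} (−1)^{n−|S|} det(Σ_{i∈S} ωᵢ) = n! · det(ω₁, …, ωₙ) is n! times the mixed determinant of ω₁, …, ωₙ. -/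
noncomputable section

open Module

theorem AlternatingMap.map_comp_endomorphism {n : ℕ} {V : Type*} [AddCommGroup V] [Module ℝ V]
    [FiniteDimensional ℝ V] (hdim : finrank ℝ V = n) (f : V [⋀^Fin n]→ₗ[ℝ] ℝ)
    (φ : V →ₗ[ℝ] V) (v : Fin n → V) :
    f (fun i => φ (v i)) = LinearMap.det φ * f v := by
  let b := finBasisOfFinrankEq ℝ V hdim
  have h (w : Fin n → V) : f w = f b * b.det w := by
    conv_lhs => rw [f.eq_smul_basis_det b]
    simp
  rw [h, h v]
  have := b.det_comp φ v
  simp only [Function.comp_def] at this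
  rw [this]
  ring

theorem Finset.sum_superset_neg_one_pow {ι : Type*} [Fintype ι] [DecidableEq ι] (A : Finset ι) :
    ∑ S : Finset ι, (if A ⊆ S then (-1 : ℝ) ^ (Fintype.card ι - S.card) else 0) =
      if A = Finset.univ then 1 else 0 := by
  have h := congrArg (Int.cast : ℤ → ℝ) (Finset.sum_powerset_neg_one_pow_card (x := Aᶜ))
  push_cast at h
  simp only [Finset.compl_eq_empty_iff] at h
  rw [← h, ← Finset.sum_filter]
  refine Finset.sum_nbij' (fun S => Sᶜ) (fun S => Sᶜ) ?_ ?_ ?_ ?_ ?_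
  · simp
  · intro S hS
    simpa [Finset.subset_compl_comm] using hS
  · simp
  · simp
  · simp [Finset.card_compl]

/-- The polarization formula for a multilinear map. -/
theorem MultilinearMap.sum_perm_eq_sum_finset {ι V W : Type*} [Fintype ι] [DecidableEq ι]
    [AddCommGroup V] [Module ℝ V] [AddCommGroup W] [Module ℝ W]
    (F : MultilinearMap ℝ (fun _ : ι => V) W) (x : ι → ι → V) :
    ∑ σ : Equiv.Perm ι, F (fun i => x (σ i) i) =
      ∑ S : Finset ι, (-1 : ℝ) ^ (Fintype.card ι - S.card) • F (fun i => ∑ j ∈ S, x j i) := by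
  have expand (S : Finset ι) : F (fun i => ∑ j ∈ S, x j i) =
      ∑ g : ι → ι, if Finset.univ.image g ⊆ S then F (fun i => x (g i) i) else 0 := by
    rw [F.map_sum_finset (fun i j => x j i) (fun _ => S), ← Finset.sum_filter]
    refine Finset.sum_congr ?_ fun _ _ => rfl
    ext g
    simp [Finset.image_subset_iff]
  simp_rw [expand, Finset.smul_sum]
  rw [Finset.sum_comm]
  have collect (g : ι → ι) : ∑ S : Finset ι, (-1 : ℝ) ^ (Fintype.card ι - S.card) •
      (if Finset.univ.image g ⊆ S then F (fun i => x (g i) i) else 0) =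
      if Function.Bijective g then F (fun i => x (g i) i) else 0 := by
    have h := Finset.sum_superset_neg_one_pow (Finset.univ.image g)
    simp only [← Finset.coe_eq_univ, Finset.coe_image, Finset.coe_univ, Set.image_univ, Set.range_eq_univ,
      ← Finite.injective_iff_surjective, Finite.injective_iff_bijective] at h
    calc _ = (∑ S : Finset ι, if Finset.univ.image g ⊆ S then
          (-1 : ℝ) ^ (Fintype.card ι - S.card) else 0) • F (fun i => x (g i) i) := by
          rw [Finset.sum_smul]
          refine Finset.sum_congr rfl fun S _ => ?_
          split_ifs <;> simp
      _ = _ := by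
          rw [h]
          rw [ite_smul, one_smul, zero_smul]
  simp_rw [collect]
  rw [← Finset.sum_filter]
  refine Finset.sum_bij (fun σ _ => ⇑σ) ?_ ?_ ?_ ?_
  · intro σ _
    simp
  · intro σ _ τ _ h
    exact DFunLike.coe_injective h
  · intro g hg
    exact ⟨Equiv.ofBijective g (by simpa using hg), Finset.mem_univ _, rfl⟩
  · intro _ _
    rfl

/-- **Mixed determinants via alternating forms**: for endomorphisms `ω₁, …, ωₙ` of an
`n`-dimensional real vector space, an alternating `n`-form `f` and vectors `v₁, …, vₙ`,
the symmetrized expression `Σ_σ f(ω_{σ(1)} v₁, …, ω_{σ(n)} vₙ)` equals `c · f(v₁, …, vₙ)`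
where `c = Σ_{∅ ≠ S ⊆ {1,…,n}} (−1)^{n−|S|} det(Σ_{i∈S} ωᵢ)` is `n!` times the mixed
determinant of `ω₁, …, ωₙ`. -/
theorem sum_perm_alternating_eq_mixed_det_smul
    (n : ℕ) (hn : 1 ≤ n) (V : Type*) [AddCommGroup V] [Module ℝ V]
    [FiniteDimensional ℝ V] (hdim : finrank ℝ V = n)
    (ω : Fin n → V →ₗ[ℝ] V) (f : V [⋀^Fin n]→ₗ[ℝ] ℝ) (v : Fin n → V) :
    ∑ σ : Equiv.Perm (Fin n), f (fun i => ω (σ i) (v i)) =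
      (∑ S ∈ (Finset.univ : Finset (Fin n)).powerset.filter (fun S => S.Nonempty),
          (-1 : ℝ) ^ (n - S.card) * LinearMap.det (∑ i ∈ S, ω i)) * f v := by
  have hpol := f.toMultilinearMap.sum_perm_eq_sum_finset (fun j i => ω j (v i))
  simp only [AlternatingMap.coe_multilinearMap, Fintype.card_fin, smul_eq_mul] at hpol
  rw [hpol, Finset.sum_mul, Finset.powerset_univ]
  symm
  refine Finset.sum_subset_zero_on_sdiff (Finset.filter_subset _ _) ?_ ?_
  · intro S hS
    obtain rfl : S = ∅ := by simpa [Finset.not_nonempty_iff_eq_empty] using hS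
    have : NeZero n := ⟨by omega⟩
    simp [f.map_coord_zero (0 : Fin n)]
  · intro S _
    rw [mul_assoc, ← f.map_comp_endomorphism hdim]
    simp [LinearMap.sum_apply]
end
end

section
/- Let A and B be symmetric 2×2 real matrices with det B > 0 and vanishing mixed determinant det(A, B) = 0, i.e. det(A + B) = det A + det B. Then det A ≤ 0; moreover, det A = 0 only if A = 0. -/
noncomputable section

/-- If `A`, `B` are symmetric `2 × 2` real matrices with `det B > 0` and vanishing mixed
determinant (`det (A + B) = det A + det B`), then `det A ≤ 0`, with `det A = 0` only if
`A = 0`. -/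
theorem det_nonpos_of_mixed_det_zero (A B : Matrix (Fin 2) (Fin 2) ℝ)
    (hA : A.IsSymm) (hB : B.IsSymm) (hBpos : 0 < B.det)
    (hmix : (A + B).det = A.det + B.det) :
    A.det ≤ 0 ∧ (A.det = 0 → A = 0) := by
  have hA' : A 1 0 = A 0 1 := hA.apply 0 1
  have hB' : B 1 0 = B 0 1 := hB.apply 0 1
  simp only [Matrix.det_fin_two, Matrix.add_apply, hA', hB'] at hBpos hmix ⊢
  have hp : B 0 0 ≠ 0 := by
    intro h
    rw [h] at hBpos
    nlinarith [sq_nonneg (B 0 1)]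
  have hp2 : 0 < B 0 0 ^ 2 := by positivity
  have key : B 0 0 ^ 2 * (A 0 0 * A 1 1 - A 0 1 * A 0 1) =
      -((B 0 0 * A 0 1 - A 0 0 * B 0 1) ^ 2 +
        A 0 0 ^ 2 * (B 0 0 * B 1 1 - B 0 1 * B 0 1)) := by
    linear_combination A 0 0 * B 0 0 * hmix
  have hsq := sq_nonneg (B 0 0 * A 0 1 - A 0 0 * B 0 1)
  have hmul := mul_nonneg (sq_nonneg (A 0 0)) hBpos.le
  refine ⟨nonpos_of_mul_nonpos_right (by linarith) hp2, fun h => ?_⟩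
  rw [h, mul_zero] at key
  have ha : A 0 0 = 0 := by
    have hzero : A 0 0 ^ 2 * (B 0 0 * B 1 1 - B 0 1 * B 0 1) = 0 := by linarith
    simpa [hBpos.ne'] using hzero
  have hb : A 0 1 = 0 := by simpa [ha] using h
  have hc : A 1 1 = 0 := by
    have hzero : A 1 1 * B 0 0 = 0 := by
      rw [ha, hb] at hmix
      linarith
    simpa [hp] using hzero
  ext i j
  fin_cases i <;> fin_cases j <;> simp [ha, hb, hc, hA']
end
end

section
/- Let B : ℝ → Matrix (Fin 2) (Fin 2) ℝ be a family of symmetric 2×2 real matrices (B(t)ᵀ = B(t) for all t) that is differentiable at t = 0 with derivative Ḃ (HasDerivAt B Ḃ 0). Assume det(B 0) > 0 and that the function t ↦ det(B t) has derivative 0 at t = 0. Then det Ḃ ≤ 0; moreover, det Ḃ = 0 only if Ḃ = 0. -/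
noncomputable section

attribute [local instance] Matrix.normedAddCommGroup Matrix.normedSpace

/-- If the binary quadratic form with coefficients `a, b, c` is definite and its mixed determinant
with the form with coefficients `x, y, z` vanishes, then the latter has nonpositive determinant,
and it is zero if its determinant vanishes. -/
theorem det_nonpos_of_mixed_det_eq_zero {a b c x y z : ℝ} (hpos : 0 < a * c - b * b)
    (hmixed : x * c + a * z - 2 * b * y = 0) :
    x * z - y * y ≤ 0 ∧ (x * z - y * y = 0 → x = 0 ∧ y = 0 ∧ z = 0) := by
  have ha : a ≠ 0 := by
    rintro rfl
    nlinarith [mul_self_nonneg b]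
  have key : a ^ 2 * (x * z - y * y) = -((a * y - b * x) ^ 2 + x ^ 2 * (a * c - b * b)) := by
    linear_combination a * x * hmixed
  have ha2 : 0 < a ^ 2 := by positivity
  have hx2 : 0 ≤ x ^ 2 * (a * c - b * b) := by positivity
  refine ⟨?_, fun h => ?_⟩
  · by_contra! h
    linarith [mul_pos ha2 h, sq_nonneg (a * y - b * x)]
  · rw [h] at key
    have hx : x = 0 := by
      have : x ^ 2 * (a * c - b * b) = 0 := by linarith [sq_nonneg (a * y - b * x)]
      simpa [hpos.ne'] using this
    subst hx
    have hy : y = 0 := by simpa [ha] using key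
    subst hy
    exact ⟨rfl, rfl, by simpa [ha] using hmixed⟩

/-- If `B t` is a family of symmetric `2 × 2` real matrices with derivative `Ḃ` at
`t = 0`, `det (B 0) > 0`, and `t ↦ det (B t)` has derivative `0` at `t = 0`, then
`det Ḃ ≤ 0`, with `det Ḃ = 0` only if `Ḃ = 0`. -/
theorem det_deriv_nonpos_of_det_pos (B : ℝ → Matrix (Fin 2) (Fin 2) ℝ)
    (hsymm : ∀ t, (B t).IsSymm)
    (Bdot : Matrix (Fin 2) (Fin 2) ℝ) (hB : HasDerivAt B Bdot 0)
    (hpos : 0 < (B 0).det)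
    (hdet : HasDerivAt (fun t => (B t).det) 0 0) :
    Bdot.det ≤ 0 ∧ (Bdot.det = 0 → Bdot = 0) := by
  have hentry (i j : Fin 2) : HasDerivAt (fun t => B t i j) (Bdot i j) 0 :=
    hasDerivAt_pi.1 (hasDerivAt_pi.1 hB i) j
  have hB_symm : B 0 1 0 = B 0 0 1 := (hsymm 0).apply 0 1
  have hBdot_symm : Bdot 1 0 = Bdot 0 1 :=
    (hentry 1 0).unique <| by simpa only [(hsymm _).apply 0 1] using hentry 0 1
  have hmixed : Bdot 0 0 * B 0 1 1 + B 0 0 0 * Bdot 1 1 - 2 * B 0 0 1 * Bdot 0 1 = 0 := by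
    simp only [Matrix.det_fin_two] at hdet
    have h := (((hentry 0 0).mul (hentry 1 1)).sub ((hentry 0 1).mul (hentry 1 0))).unique hdet
    rw [hB_symm, hBdot_symm] at h
    linarith
  rw [Matrix.det_fin_two, hB_symm] at hpos
  rw [Matrix.det_fin_two, hBdot_symm]
  refine (det_nonpos_of_mixed_det_eq_zero hpos hmixed).imp_right fun h hzero => ?_
  obtain ⟨hx, hy, hz⟩ := h hzero
  ext i j
  fin_cases i <;> fin_cases j <;> simp [hx, hy, hz, hBdot_symm]
end
end
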